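/- arXiv:2203.08356 — 5 statements merged into one kernel-verified Lean document; each statement's English description precedes it below -/
import Mathlib

section
/- Let d, r, k be natural numbers with 1 ≤ d and d ≤ 2·r. Then the number of r-element subsets R of {0, 1, …, d−1} for which there exists an index i with i + k ≤ d such that R is disjoint from the block {i, i+1, …, i+k−1}, multiplied by 2^k, is at most d · C(d, r). Formally: ((Finset.range d).powersetCard r).filter (fun R => ∃ i, i + k ≤ d ∧ ∀ x ∈ Finset.Ico i (i + k), x ∉ R) has cardinality N satisfying N · 2^k ≤ d · Nat.choose d r. -/
theorem two_mul_choose_le_choose_succ {n r : ℕ} (h : n + 1 ≤ 2 * r) :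
    2 * n.choose r ≤ (n + 1).choose r := by
  obtain _ | s := r
  · omega
  have hle : n.choose (s + 1) ≤ n.choose s := by
    refine Nat.le_of_mul_le_mul_right (c := s + 1) ?_ s.succ_pos
    rw [Nat.choose_succ_right_eq]
    exact Nat.mul_le_mul_left _ (by omega)
  rw [Nat.choose_succ_succ']
  omega

theorem choose_mul_two_pow_le_choose_add {n r k : ℕ} (h : n + k ≤ 2 * r) :
    n.choose r * 2 ^ k ≤ (n + k).choose r := by
  induction k with
  | zero => simp
  | succ k ih =>
    have hk := ih (by omega)
    have hs := two_mul_choose_le_choose_succ (n := n + k) (r := r) (by omega)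
    rw [pow_succ, ← add_assoc]
    linarith

theorem card_powersetCard_range_sdiff_Ico {d i k : ℕ} (r : ℕ) (h : i + k ≤ d) :
    ((Finset.range d \ Finset.Ico i (i + k)).powersetCard r).card = (d - k).choose r := by
  have hsub : Finset.Ico i (i + k) ⊆ Finset.range d := fun x hx => by
    simp only [Finset.mem_Ico, Finset.mem_range] at hx ⊢
    omega
  rw [Finset.card_powersetCard, Finset.card_sdiff_of_subset hsub, Finset.card_range,
    Nat.card_Ico, Nat.add_sub_cancel_left]

open Classical in
theorem count_subsets_avoiding_some_block (d r k : ℕ) (h1 : 1 ≤ d) (h2 : d ≤ 2 * r) :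
    ((((Finset.range d).powersetCard r).filter
        (fun R => ∃ i, i + k ≤ d ∧ ∀ x ∈ Finset.Ico i (i + k), x ∉ R)).card) * 2 ^ k ≤
      d * Nat.choose d r := by
  obtain rfl | hk := Nat.eq_zero_or_pos k
  · calc _ ≤ ((Finset.range d).powersetCard r).card * 2 ^ 0 :=
          Nat.mul_le_mul_right _ (Finset.card_le_card fun R hR => by simp_all only [Finset.mem_filter])
      _ = 1 * d.choose r := by simp
      _ ≤ d * d.choose r := Nat.mul_le_mul_right _ h1
  obtain hdk | hkd := Nat.lt_or_ge d k
  · rw [Finset.filter_false_of_mem, Finset.card_empty, zero_mul]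
    · exact Nat.zero_le _
    · rintro R - ⟨i, hi, -⟩
      omega
  have hcover : ((Finset.range d).powersetCard r).filter
        (fun R => ∃ i, i + k ≤ d ∧ ∀ x ∈ Finset.Ico i (i + k), x ∉ R) ⊆
      (Finset.range (d + 1 - k)).biUnion
        fun i => (Finset.range d \ Finset.Ico i (i + k)).powersetCard r := by
    intro R hR
    simp only [Finset.mem_filter, Finset.mem_powersetCard] at hR
    obtain ⟨⟨hRd, hRr⟩, i, hi, hdisj⟩ := hR
    refine Finset.mem_biUnion.2 ⟨i, Finset.mem_range.2 (by omega), ?_⟩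
    exact Finset.mem_powersetCard.2
      ⟨fun x hx => Finset.mem_sdiff.2 ⟨hRd hx, fun hxi => hdisj x hxi hx⟩, hRr⟩
  have hcard := (Finset.card_le_card hcover).trans
    (Finset.card_biUnion_le_card_mul _ _ ((d - k).choose r) fun i hi =>
      (card_powersetCard_range_sdiff_Ico r (by rw [Finset.mem_range] at hi; omega)).le)
  rw [Finset.card_range] at hcard
  have hchoose := choose_mul_two_pow_le_choose_add (n := d - k) (r := r) (k := k) (by omega)
  rw [Nat.sub_add_cancel hkd] at hchoose
  calc _ ≤ (d + 1 - k) * (d - k).choose r * 2 ^ k := Nat.mul_le_mul_right _ hcard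
    _ = (d + 1 - k) * ((d - k).choose r * 2 ^ k) := mul_assoc _ _ _
    _ ≤ d * d.choose r := Nat.mul_le_mul (by omega) hchoose
end

section
/- Let L be a natural number with L ≥ 1, and let a, b be natural numbers with a < 2^L and b < 2^L. Then a < b if and only if there exists a unique pair (s, t) of natural numbers with s ≥ 1 such that a lies in the left half of the dyadic interval determined by (s, t) and b lies in its right half; that is, a < b ↔ ∃! (s, t) : ℕ × ℕ, 1 ≤ s ∧ 2^s·t ≤ a ∧ a < 2^s·t + 2^(s−1) ∧ 2^s·t + 2^(s−1) ≤ b ∧ b < 2^s·(t+1). -/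
theorem dyadic_halves_iff_div_eq (a b k t : ℕ) :
    (2 ^ (k + 1) * t ≤ a ∧ a < 2 ^ (k + 1) * t + 2 ^ k ∧
      2 ^ (k + 1) * t + 2 ^ k ≤ b ∧ b < 2 ^ (k + 1) * (t + 1)) ↔
    a / 2 ^ k = 2 * t ∧ b / 2 ^ k = 2 * t + 1 := by
  have hk : 0 < 2 ^ k := by positivity
  rw [Nat.div_eq_iff hk, Nat.div_eq_iff hk]
  have h₁ : 2 ^ (k + 1) * t = 2 * t * 2 ^ k := by ring
  have h₂ : 2 ^ (k + 1) * (t + 1) = 2 * t * 2 ^ k + 2 * 2 ^ k := by ring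
  have h₃ : (2 * t + 1) * 2 ^ k = 2 * t * 2 ^ k + 2 ^ k := by ring
  rw [h₁, h₂, h₃]
  generalize 2 * t * 2 ^ k = x
  omega

theorem div_two_pow_eq_of_le {a b m n : ℕ} (hmn : m ≤ n) (h : a / 2 ^ m = b / 2 ^ m) :
    a / 2 ^ n = b / 2 ^ n := by
  obtain ⟨d, rfl⟩ := Nat.exists_eq_add_of_le hmn
  rw [pow_add, ← Nat.div_div_eq_div_mul, ← Nat.div_div_eq_div_mul, h]

theorem exists_div_two_pow_eq_of_lt {L a b : ℕ} (ha : a < 2 ^ L) (hb : b < 2 ^ L)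
    (hab : a < b) : ∃ k t, a / 2 ^ k = 2 * t ∧ b / 2 ^ k = 2 * t + 1 := by
  have hex : ∃ s, a / 2 ^ s = b / 2 ^ s :=
    ⟨L, by rw [Nat.div_eq_of_lt ha, Nat.div_eq_of_lt hb]⟩
  have hspec := Nat.find_spec hex
  cases hs : Nat.find hex with
  | zero =>
    rw [hs] at hspec
    simp only [pow_zero, Nat.div_one] at hspec
    omega
  | succ k =>
    have hne : a / 2 ^ k ≠ b / 2 ^ k := Nat.find_min hex (by omega)
    have hle : a / 2 ^ k ≤ b / 2 ^ k := Nat.div_le_div_right hab.le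
    rw [hs, pow_succ, ← Nat.div_div_eq_div_mul, ← Nat.div_div_eq_div_mul] at hspec
    exact ⟨k, a / 2 ^ k / 2, by omega, by omega⟩

theorem le_of_div_two_pow_eq {a b k l t u : ℕ}
    (hat : a / 2 ^ k = 2 * t) (hbt : b / 2 ^ k = 2 * t + 1)
    (hau : a / 2 ^ l = 2 * u) (hbu : b / 2 ^ l = 2 * u + 1) : k ≤ l := by
  by_contra! hlt
  have h : a / 2 ^ (l + 1) = b / 2 ^ (l + 1) := by
    rw [pow_succ, ← Nat.div_div_eq_div_mul, ← Nat.div_div_eq_div_mul]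
    omega
  have := div_two_pow_eq_of_le hlt h
  omega

theorem lt_iff_unique_dyadic_interval (L a b : ℕ) (hL : 1 ≤ L)
    (ha : a < 2 ^ L) (hb : b < 2 ^ L) :
    a < b ↔ ∃! p : ℕ × ℕ, 1 ≤ p.1 ∧
      2 ^ p.1 * p.2 ≤ a ∧ a < 2 ^ p.1 * p.2 + 2 ^ (p.1 - 1) ∧
      2 ^ p.1 * p.2 + 2 ^ (p.1 - 1) ≤ b ∧ b < 2 ^ p.1 * (p.2 + 1) := by
  constructor
  · intro hab
    obtain ⟨k, t, hat, hbt⟩ := exists_div_two_pow_eq_of_lt ha hb hab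
    refine ⟨(k + 1, t), ⟨by simp, (dyadic_halves_iff_div_eq a b k t).2 ⟨hat, hbt⟩⟩, ?_⟩
    rintro ⟨s, u⟩ ⟨hs, h⟩
    obtain ⟨l, rfl⟩ := Nat.exists_eq_add_of_le' hs
    obtain ⟨hau, hbu⟩ := (dyadic_halves_iff_div_eq a b l u).1 h
    obtain rfl : k = l := le_antisymm (le_of_div_two_pow_eq hat hbt hau hbu)
      (le_of_div_two_pow_eq hau hbu hat hbt)
    obtain rfl : t = u := by omega
    rfl
  · rintro ⟨p, ⟨-, -, hap, hpb, -⟩, -⟩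
    exact hap.trans_le hpb
end

section
/- Let n, d, L be natural numbers with L ≥ 1, let A : Fin n → Fin d → ℝ and B : Fin d → Fin n → ℝ, and fix k : Fin d. Let D ⊆ ℝ be the set D = {A i k' − A i k : i : Fin n, k' : Fin d} ∪ {B k j − B k' j : j : Fin n, k' : Fin d}, and suppose ρ : ℝ → ℕ satisfies: (a) for all x, y ∈ D, x < y ↔ ρ(x) < ρ(y); and (b) ρ(x) < 2^L for all x ∈ D. Then for every i : Fin n and j : Fin n: (∃ k' : Fin d, A i k' + B k' j < A i k + B k j) if and only if (∃ k' : Fin d, ∃ s t : ℕ, 1 ≤ s ∧ 2^s·t ≤ ρ(A i k' − A i k) ∧ ρ(A i k' − A i k) < 2^s·t + 2^(s−1) ∧ 2^s·t + 2^(s−1) ≤ ρ(B k j − B k' j) ∧ ρ(B k j − B k' j) < 2^s·(t+1)). -/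
/-- Two natural numbers `a < b` are separated by the midpoint of some dyadic interval
containing both of them. -/
theorem Nat.exists_dyadic_separation_of_lt {a b : ℕ} (h : a < b) :
    ∃ s t : ℕ, 1 ≤ s ∧ 2 ^ s * t ≤ a ∧ a < 2 ^ s * t + 2 ^ (s - 1) ∧
      2 ^ s * t + 2 ^ (s - 1) ≤ b ∧ b < 2 ^ s * (t + 1) := by
  induction b using Nat.strong_induction_on generalizing a with
  | _ b ih =>
    by_cases hab : a / 2 < b / 2
    · obtain ⟨s, t, hs, h₁, h₂, h₃, h₄⟩ := ih (b / 2) (by omega) hab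
      obtain ⟨r, rfl⟩ : ∃ r, s = r + 1 := ⟨s - 1, by omega⟩
      refine ⟨r + 2, t, by omega, ?_⟩
      simp only [Nat.add_sub_cancel, show r + 2 - 1 = r + 1 from rfl] at *
      have hp : 2 ^ (r + 2) * t = 2 * (2 ^ (r + 1) * t) := by ring
      have hq : 2 ^ (r + 2) * (t + 1) = 2 * (2 ^ (r + 1) * (t + 1)) := by ring
      have hr : 2 ^ (r + 1) = 2 * 2 ^ r := by ring
      refine ⟨?_, ?_, ?_, ?_⟩ <;> omega
    · refine ⟨1, a / 2, le_rfl, ?_⟩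
      norm_num
      omega


theorem minplus_triangle_correctness (n d L : ℕ) (hL : 1 ≤ L)
    (A : Fin n → Fin d → ℝ) (B : Fin d → Fin n → ℝ) (k : Fin d)
    (D : Set ℝ)
    (hD : D = {x : ℝ | ∃ (i : Fin n) (k' : Fin d), x = A i k' - A i k} ∪
              {x : ℝ | ∃ (j : Fin n) (k' : Fin d), x = B k j - B k' j})
    (ρ : ℝ → ℕ)
    (hρ : ∀ x ∈ D, ∀ y ∈ D, (x < y ↔ ρ x < ρ y))
    (hρL : ∀ x ∈ D, ρ x < 2 ^ L) :
    ∀ i j : Fin n,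
      (∃ k' : Fin d, A i k' + B k' j < A i k + B k j) ↔
      (∃ (k' : Fin d) (s t : ℕ), 1 ≤ s ∧
        2 ^ s * t ≤ ρ (A i k' - A i k) ∧
        ρ (A i k' - A i k) < 2 ^ s * t + 2 ^ (s - 1) ∧
        2 ^ s * t + 2 ^ (s - 1) ≤ ρ (B k j - B k' j) ∧
        ρ (B k j - B k' j) < 2 ^ s * (t + 1)) := by
  intro i j
  have key (k' : Fin d) : A i k' + B k' j < A i k + B k j ↔
      ρ (A i k' - A i k) < ρ (B k j - B k' j) := by
    rw [← hρ _ (hD ▸ Or.inl ⟨i, k', rfl⟩) _ (hD ▸ Or.inr ⟨j, k', rfl⟩)]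
    constructor <;> intro h <;> linarith
  constructor
  · rintro ⟨k', h⟩
    exact ⟨k', Nat.exists_dyadic_separation_of_lt ((key k').1 h)⟩
  · rintro ⟨k', s, t, -, -, h₂, h₃, -⟩
    exact ⟨k', (key k').2 (h₂.trans_le h₃)⟩
end

section
/- Let dA, dB, L be natural numbers with L ≥ 1, let f⁻, f⁺ : Fin dA → ℝ and g⁻, g⁺ : Fin dB → ℝ, let D ⊆ ℝ be the union of the ranges of f⁻, f⁺, g⁻, g⁺, and suppose ρ : ℝ → ℕ satisfies: (a) for all x, y ∈ D, x < y ↔ ρ(x) < ρ(y); and (b) ρ(x) < 2^L for all x ∈ D. Then the following are equivalent: (1) there exist k' : Fin dA and ℓ' : Fin dB with f⁻ k' < g⁻ ℓ' and f⁺ k' < g⁺ ℓ'; (2) there exist natural numbers s⁻, t⁻, s⁺, t⁺ with s⁻ ≥ 1 and s⁺ ≥ 1 such that [there exists k' : Fin dA with ρ(f⁻ k') in the left half of the dyadic interval (s⁻, t⁻) and ρ(f⁺ k') in the left half of the dyadic interval (s⁺, t⁺)] and [there exists ℓ' : Fin dB with ρ(g⁻ ℓ') in the right half of the dyadic interval (s⁻,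 t⁻) and ρ(g⁺ ℓ') in the right half of the dyadic interval (s⁺, t⁺)] — note that the two inner existential quantifiers over k' and ℓ' are independent of each other. -/
/-- Any two naturals `a < b` are separated by the midpoint of some dyadic interval. -/
theorem exists_dyadic_separating {a b : ℕ} (hab : a < b) :
    ∃ s t : ℕ, 1 ≤ s ∧ 2 ^ s * t ≤ a ∧ a < 2 ^ s * t + 2 ^ (s - 1) ∧
      2 ^ s * t + 2 ^ (s - 1) ≤ b ∧ b < 2 ^ s * (t + 1) := by
  induction b using Nat.strong_induction_on generalizing a with
  | _ b ih =>
    by_cases h : a / 2 = b / 2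
    · exact ⟨1, a / 2, le_rfl, by omega, by omega, by omega, by omega⟩
    · obtain ⟨s, t, hs, h₁, h₂, h₃, h₄⟩ :=
        ih (b / 2) (by omega) (a := a / 2) (by omega)
      obtain ⟨n, rfl⟩ := Nat.exists_eq_add_of_le' hs
      have hmul : 2 ^ (n + 1 + 1) * t = 2 * (2 ^ (n + 1) * t) := by ring
      have hpow : 2 ^ (n + 1) = 2 * 2 ^ n := by ring
      have hpow' : 2 ^ (n + 1 + 1) = 2 * 2 ^ (n + 1) := by ring
      simp only [Nat.add_sub_cancel, mul_add, mul_one] at h₂ h₃ h₄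
      refine ⟨n + 1 + 1, t, by omega, by omega, ?_, ?_, ?_⟩ <;>
        simp only [Nat.add_sub_cancel, mul_add, mul_one] <;> omega

theorem threesum_triangle_correctness (dA dB L : ℕ) (hL : 1 ≤ L)
    (fm fp : Fin dA → ℝ) (gm gp : Fin dB → ℝ)
    (D : Set ℝ)
    (hD : D = Set.range fm ∪ Set.range fp ∪ Set.range gm ∪ Set.range gp)
    (ρ : ℝ → ℕ)
    (hρ : ∀ x ∈ D, ∀ y ∈ D, (x < y ↔ ρ x < ρ y))
    (hρL : ∀ x ∈ D, ρ x < 2 ^ L) :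
    (∃ (k' : Fin dA) (ℓ' : Fin dB), fm k' < gm ℓ' ∧ fp k' < gp ℓ') ↔
    (∃ sm tm sp tp : ℕ, 1 ≤ sm ∧ 1 ≤ sp ∧
      (∃ k' : Fin dA,
        2 ^ sm * tm ≤ ρ (fm k') ∧ ρ (fm k') < 2 ^ sm * tm + 2 ^ (sm - 1) ∧
        2 ^ sp * tp ≤ ρ (fp k') ∧ ρ (fp k') < 2 ^ sp * tp + 2 ^ (sp - 1)) ∧
      (∃ ℓ' : Fin dB,
        2 ^ sm * tm + 2 ^ (sm - 1) ≤ ρ (gm ℓ') ∧ ρ (gm ℓ') < 2 ^ sm * (tm + 1) ∧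
        2 ^ sp * tp + 2 ^ (sp - 1) ≤ ρ (gp ℓ') ∧ ρ (gp ℓ') < 2 ^ sp * (tp + 1))) := by
  subst hD
  constructor
  · rintro ⟨k, l, hm, hp⟩
    obtain ⟨sm, tm, hsm, m₁, m₂, m₃, m₄⟩ :=
      exists_dyadic_separating ((hρ (fm k) (by simp) (gm l) (by simp)).1 hm)
    obtain ⟨sp, tp, hsp, p₁, p₂, p₃, p₄⟩ :=
      exists_dyadic_separating ((hρ (fp k) (by simp) (gp l) (by simp)).1 hp)
    exact ⟨sm, tm, sp, tp, hsm, hsp, ⟨k, m₁, m₂, p₁, p₂⟩, ⟨l, m₃, m₄, p₃, p₄⟩⟩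
  · rintro ⟨sm, tm, sp, tp, -, -, ⟨k, -, m₂, -, p₂⟩, ⟨l, m₃, -, p₃, -⟩⟩
    exact ⟨k, l, (hρ (fm k) (by simp) (gm l) (by simp)).2 (m₂.trans_le m₃),
      (hρ (fp k) (by simp) (gp l) (by simp)).2 (p₂.trans_le p₃)⟩
end

section
/- Let V be a type, G : SimpleGraph V, K a type of colors, color : V → K, pt : K → Fin 3, p a natural number, and idx : V → Fin p. Assume: (i) for all u, v : V, if G.Adj u v then pt (color u) ≠ pt (color v) (the graph is tripartite with parts determined by the colors); and (ii) for all u, v : V, if color u = color v and idx u = idx v then u = v (at most p vertices share any given color). For i, j, k : Fin p define S i j k := {v : V | idx v = (if pt (color v) = 0 then i else if pt (color v) = 1 then j else k)}. Then: (a) for all a, b, c : K, G contains a triangle with vertex colors a, b, c (i.e., there exist x, y, z with G.Adj x y, G.Adj y z, G.Adj x z, color x = a, color y = b, color z = c) if and only if there exist i, j, k : Fin p and a triangle x, y, z with those colors all of whose vertices lie in S i j k; and (b) for every i, j, k : Fin p and every a : K, any two vertices of S i j k having color a are equal (each S i j k contains at most one vertex of each color). -/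
theorem Fin.ite_zero_one_two_eq_apply {α : Type*} (f : Fin 3 → α) (t : Fin 3) :
    (if t = 0 then f 0 else if t = 1 then f 1 else f 2) = f t := by
  fin_cases t <;> rfl

theorem tricoLight_split (V K : Type*) (G : SimpleGraph V) (color : V → K)
    (pt : K → Fin 3) (p : ℕ) (idx : V → Fin p)
    (htri : ∀ u v : V, G.Adj u v → pt (color u) ≠ pt (color v))
    (hlight : ∀ u v : V, color u = color v → idx u = idx v → u = v) :
    let S : Fin p → Fin p → Fin p → Set V := fun i j k =>
      {v : V | idx v = (if pt (color v) = 0 then i else if pt (color v) = 1 then j else k)}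
    (∀ a b c : K,
      (∃ x y z : V, G.Adj x y ∧ G.Adj y z ∧ G.Adj x z ∧
        color x = a ∧ color y = b ∧ color z = c) ↔
      (∃ i j k : Fin p, ∃ x y z : V,
        x ∈ S i j k ∧ y ∈ S i j k ∧ z ∈ S i j k ∧
        G.Adj x y ∧ G.Adj y z ∧ G.Adj x z ∧
        color x = a ∧ color y = b ∧ color z = c)) ∧
    (∀ i j k : Fin p, ∀ a : K, ∀ u v : V,
      u ∈ S i j k → v ∈ S i j k → color u = a → color v = a → u = v) := by
  intro S
  refine ⟨fun a b c => ⟨?_, ?_⟩, ?_⟩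
  · rintro ⟨x, y, z, hxy, hyz, hxz, ha, hb, hc⟩
    have nxy := htri x y hxy
    have nyz := htri y z hyz
    have nxz := htri x z hxz
    let f : Fin 3 → Fin p := fun t =>
      if t = pt (color x) then idx x else if t = pt (color y) then idx y else idx z
    have mem : ∀ v, idx v = f (pt (color v)) → v ∈ S (f 0) (f 1) (f 2) := fun v hv =>
      hv.trans (Fin.ite_zero_one_two_eq_apply f _).symm
    exact ⟨f 0, f 1, f 2, x, y, z, mem x (by simp [f]), mem y (by simp [f, nxy.symm]),
      mem z (by simp [f, nxz.symm, nyz.symm]), hxy, hyz, hxz, ha, hb, hc⟩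
  · rintro ⟨i, j, k, x, y, z, -, -, -, h⟩
    exact ⟨x, y, z, h⟩
  · intro i j k a u v hu hv hua hva
    have huv : color u = color v := hua.trans hva.symm
    refine hlight u v huv ?_
    simp only [S, Set.mem_ofPred_eq] at hu hv
    rw [hu, hv, huv]
end
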